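/- Under the hypotheses: Ω̃ symmetric g×g with Im Ω̃ > 0, Δ = diag(δ_1,...,δ_n) with δ_j ≥ 1 integers, Φ a complex g×n matrix with ΦΔ having all columns in Δ̃ℤ^g for a diagonal integer matrix Δ̃ with θ(·|Ω̃) periodic with respect to Δ̃ℤ^g — or simply assume θ(Φ(z+λ) − γ|Ω̃) = θ(Φz − γ|Ω̃) for all λ ∈ Δℤ^n — together with an integer g×n matrix P satisfying ΦΩ = Ω̃P, PᵀΦ = 1_n, Ω = PᵀΩ̃P. Then for every γ ∈ ℂ^g: θ(Φz − γ|Ω̃) = ∑_{ε∈ℤ^n/Δℤ^n} c_ε · θ[Δ^{-1}ε, 0](z − Pᵀγ|Ω), where c_ε = ∑_{m∈ℤ^g, Φᵀm = Δ^{-1}ε} exp(πi⟨m, Ω̃m⟩ − 2πi⟨m, γ⟩ + 2πi⟨ε, Δ^{-1}Pᵀγ⟩ − πi⟨Δ^{-1}ε, ΩΔ^{-1}ε⟩). -/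

import Mathlib

open scoped Matrix
open Complex

noncomputable def thetaTerm {ι : Type} [Fintype ι] (Ω : Matrix ι ι ℂ)
    (a b z : ι → ℂ) (n : ι → ℤ) : ℂ :=
  Complex.exp ((Real.pi : ℂ) * Complex.I *
      ((fun i => (n i : ℂ) + a i) ⬝ᵥ Ω.mulVec fun i => (n i : ℂ) + a i) +
    2 * (Real.pi : ℂ) * Complex.I *
      ((fun i => (n i : ℂ) + a i) ⬝ᵥ (z + b)))

noncomputable def theta {ι : Type} [Fintype ι] (Ω : Matrix ι ι ℂ)
    (a b z : ι → ℂ) : ℂ :=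
  ∑' n : ι → ℤ, thetaTerm Ω a b z n

lemma summable_pi_prod : ∀ {g : ℕ} (f : Fin g → ℤ → ℝ), (∀ i k, 0 ≤ f i k) →
    (∀ i, Summable (f i)) → Summable (fun m : Fin g → ℤ => ∏ i, f i (m i)) := by
  intro g
  induction g with
  | zero => intro f _ _; exact Summable.of_finite
  | succ g ih =>
    intro f h0 hs
    have h1 := ih (fun i => f i.succ) (fun i => h0 _) (fun i => hs _)
    have h2 := (hs 0).mul_of_nonneg h1 (fun k => h0 0 k)
      (fun m => Finset.prod_nonneg fun i _ => h0 _ _)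
    rw [← (Fin.consEquiv (fun _ : Fin (g+1) => ℤ)).summable_iff]
    refine h2.congr ?_
    rintro ⟨a, m⟩
    simp [Fin.prod_univ_succ, Fin.consEquiv]

lemma posDef_lower {g : ℕ} (Y : Matrix (Fin g) (Fin g) ℝ) (hY : Y.PosDef) :
    ∃ c > 0, ∀ x : Fin g → ℝ, c * ∑ i, x i ^ 2 ≤ x ⬝ᵥ Y.mulVec x := by
  have hcont : Continuous (fun x : Fin g → ℝ => x ⬝ᵥ Y.mulVec x) := by
    unfold dotProduct Matrix.mulVec dotProduct
    fun_prop
  obtain ⟨c, hc, h⟩ := (isCompact_sphere (0 : Fin g → ℝ) 1).exists_forall_le' (a := 0)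
    hcont.continuousOn (by
      intro x hx
      have hx0 : x ≠ 0 := by
        rintro rfl
        simp at hx
      simpa using hY.dotProduct_mulVec_pos hx0)
  refine ⟨c / (g + 1), by positivity, fun x => ?_⟩
  have h1 : c * ‖x‖ ^ 2 ≤ x ⬝ᵥ Y.mulVec x := by
    by_cases hx0 : x = 0
    · simp [hx0]
    have hn : 0 < ‖x‖ := norm_pos_iff.mpr hx0
    have := h (‖x‖⁻¹ • x) (by simp [norm_smul, hn.ne'])
    rw [Matrix.mulVec_smul, smul_dotProduct, dotProduct_smul, smul_eq_mul, smul_eq_mul] at this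
    calc c * ‖x‖ ^ 2 ≤ (‖x‖⁻¹ * (‖x‖⁻¹ * (x ⬝ᵥ Y.mulVec x))) * ‖x‖ ^ 2 := by gcongr
      _ = _ := by field_simp
  refine le_trans ?_ h1
  have h2 : ∑ i, x i ^ 2 ≤ g * ‖x‖ ^ 2 := by
    calc ∑ i, x i ^ 2 ≤ ∑ i : Fin g, ‖x‖ ^ 2 := by
          refine Finset.sum_le_sum fun i _ => ?_
          have hxi : |x i| ≤ ‖x‖ := norm_le_pi_norm x i
          rw [← sq_abs]
          gcongr
      _ = _ := by simp
  calc c / (g + 1) * ∑ i, x i ^ 2 ≤ c / (g + 1) * ((g + 1) * ‖x‖ ^ 2) := by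
        gcongr
        nlinarith [sq_nonneg ‖x‖]
    _ = _ := by field_simp

lemma norm_thetaTerm {g : ℕ} (Om : Matrix (Fin g) (Fin g) ℂ) (w : Fin g → ℂ) (m : Fin g → ℤ) :
    ‖thetaTerm Om 0 0 w m‖ = Real.exp (-Real.pi *
      ((fun i => (m i : ℝ)) ⬝ᵥ (Om.map Complex.im).mulVec (fun i => (m i : ℝ)))
      - 2 * Real.pi * ∑ i, m i * (w i).im) := by
  unfold thetaTerm
  rw [Complex.norm_exp]
  congr 1
  have e1 : ((fun i => (m i : ℂ) + (0 : Fin g → ℂ) i) ⬝ᵥ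
      Om.mulVec fun i => (m i : ℂ) + (0 : Fin g → ℂ) i).im =
      (fun i => (m i : ℝ)) ⬝ᵥ (Om.map Complex.im).mulVec (fun i => (m i : ℝ)) := by
    simp [dotProduct, Matrix.mulVec]
  have e2 : ((fun i => (m i : ℂ) + (0 : Fin g → ℂ) i) ⬝ᵥ (w + 0)).im = ∑ i, m i * (w i).im := by
    simp [dotProduct]
  rw [Complex.add_re, ← e1, ← e2]
  simp only [mul_re, mul_im, ofReal_re, ofReal_im, I_re, I_im, re_ofNat, im_ofNat]
  ring

lemma summable_norm_thetaTerm {g : ℕ} (Om : Matrix (Fin g) (Fin g) ℂ)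
    (hpos : (Om.map Complex.im).PosDef) (w : Fin g → ℂ) :
    Summable (fun m => ‖thetaTerm Om 0 0 w m‖) := by
  obtain ⟨c, hc, h⟩ := posDef_lower _ hpos
  have hs := summable_pi_prod
    (fun (i : Fin g) (k : ℤ) => ‖jacobiTheta₂_term k (w i) (c * I)‖) (fun _ _ => norm_nonneg _)
    (fun i => ((summable_jacobiTheta₂_term_iff _ _).mpr (by simpa using hc)).norm)
  refine Summable.of_nonneg_of_le (fun _ => norm_nonneg _) (fun m => ?_) hs
  simp only [norm_jacobiTheta₂_term, ← Real.exp_sum]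
  rw [norm_thetaTerm, Real.exp_le_exp]
  have := mul_le_mul_of_nonneg_left (h (fun i => (m i : ℝ))) Real.pi_pos.le
  simp only [Finset.sum_sub_distrib, mul_assoc, ← Finset.mul_sum]
  simp [Finset.mul_sum] at *
  simp only [mul_comm, mul_left_comm] at *
  linarith

section fourierUniq
open MeasureTheory
noncomputable local instance : MeasureSpace UnitAddCircle := ⟨AddCircle.haarAddCircle⟩
local instance : Measure.IsAddHaarMeasure (volume : Measure UnitAddCircle) :=
  inferInstanceAs (Measure.IsAddHaarMeasure AddCircle.haarAddCircle)
local instance : IsProbabilityMeasure (volume : Measure UnitAddCircle) :=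
  inferInstanceAs (IsProbabilityMeasure AddCircle.haarAddCircle)

lemma fourier_unique {g : ℕ} (a : (Fin g → ℤ) → ℂ) (ha : Summable fun m => ‖a m‖)
    (h : ∀ x : Fin g → ℝ, ∑' m, a m * Complex.exp (2 * Real.pi * I * ∑ i, (m i : ℂ) * (x i : ℂ)) = 0) :
    ∀ m, a m = 0 := by
  have hs : Summable (fun m => a m • UnitAddTorus.mFourier (d := Fin g) m) := by
    refine Summable.of_norm ?_
    simpa [norm_smul, UnitAddTorus.mFourier_norm] using ha
  have h0 : ∑' m, a m • UnitAddTorus.mFourier (d := Fin g) m = 0 := by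
    ext t
    obtain ⟨x, rfl⟩ : ∃ x : Fin g → ℝ, t = fun i => (x i : UnitAddCircle) := by
      choose x hx using fun i => QuotientAddGroup.mk_surjective (t i)
      exact ⟨x, funext fun i => (hx i).symm⟩
    rw [← ContinuousMap.tsum_apply hs]
    rw [ContinuousMap.zero_apply, ← h x]
    refine tsum_congr fun m => ?_
    simp only [UnitAddTorus.mFourier, ContinuousMap.smul_apply, ContinuousMap.coe_mk,
      smul_eq_mul, fourier_coe_apply, ← Complex.exp_sum, Finset.mul_sum]
    congr 2
    refine Finset.sum_congr rfl fun i _ => ?_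
    push_cast
    ring
  have h1 : HasSum (fun m => a m • UnitAddTorus.mFourier (d := Fin g) m) 0 := h0 ▸ hs.hasSum
  have h2 := h1.mapL (ContinuousMap.toLp (E := ℂ) 2 (volume : Measure (UnitAddTorus (Fin g))) ℂ)
  intro k
  have h3 := h2.mapL (innerSL ℂ (UnitAddTorus.mFourierLp (d := Fin g) 2 k))
  have h4 : ∀ m, innerSL ℂ (UnitAddTorus.mFourierLp (d := Fin g) 2 k)
      (ContinuousMap.toLp (E := ℂ) 2 (volume : Measure (UnitAddTorus (Fin g))) ℂ
        (a m • UnitAddTorus.mFourier (d := Fin g) m)) = if m = k then a k else 0 := by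
    intro m
    have := (orthonormal_iff_ite.mp (UnitAddTorus.orthonormal_mFourier (d := Fin g))) k m
    rw [map_smul, map_smul, innerSL_apply_apply]
    erw [this]
    by_cases hk : m = k
    · simp [hk]
    · simp [hk, Ne.symm hk]
  simp only [h4] at h3
  rw [map_zero, map_zero] at h3
  exact (hasSum_ite_eq k (a k)).unique h3
end fourierUniq

lemma thetaTerm_eq {g : ℕ} (Om : Matrix (Fin g) (Fin g) ℂ) (w : Fin g → ℂ) (m : Fin g → ℤ) :
    thetaTerm Om 0 0 w m =
      thetaTerm Om 0 0 0 m * Complex.exp (2 * Real.pi * I * ∑ i, (m i : ℂ) * w i) := by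
  unfold thetaTerm
  rw [← Complex.exp_add]
  simp [dotProduct]

lemma period_int {g : ℕ} (Om : Matrix (Fin g) (Fin g) ℂ)
    (hpos : (Om.map Complex.im).PosDef) (v : Fin g → ℂ)
    (h : ∀ w, theta Om 0 0 (w + v) = theta Om 0 0 w) (m : Fin g → ℤ) :
    ∃ k : ℤ, ∑ i, (m i : ℂ) * v i = k := by
  have hs := fun w => summable_norm_thetaTerm Om hpos w
  have hsub : ∀ w m, thetaTerm Om 0 0 0 m * (Complex.exp (2 * Real.pi * I * ∑ i, (m i : ℂ) * v i) - 1) *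
      Complex.exp (2 * Real.pi * I * ∑ i, (m i : ℂ) * w i) =
      thetaTerm Om 0 0 (w + v) m - thetaTerm Om 0 0 w m := by
    intro w m
    rw [thetaTerm_eq Om (w + v), thetaTerm_eq Om w]
    simp only [Pi.add_apply, mul_add, Finset.sum_add_distrib, Complex.exp_add]
    ring
  have key := fourier_unique
    (fun m => thetaTerm Om 0 0 0 m * (Complex.exp (2 * Real.pi * I * ∑ i, (m i : ℂ) * v i) - 1))
    (by
      have := ((hs (0 + v)).of_norm.sub (hs 0).of_norm).norm
      refine this.congr fun m => ?_
      rw [← hsub]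
      simp)
    (by
      intro x
      have e := h (fun i => (x i : ℂ))
      unfold theta at e
      rw [← sub_eq_zero, ← (hs _).of_norm.tsum_sub (hs _).of_norm] at e
      rw [← e]
      refine tsum_congr fun m => ?_
      rw [← hsub]) m
  have h1 : thetaTerm Om 0 0 0 m ≠ 0 := Complex.exp_ne_zero _
  have h2 := (mul_eq_zero.mp key).resolve_left h1
  rw [sub_eq_zero, Complex.exp_eq_one_iff] at h2
  obtain ⟨k, hk⟩ := h2
  refine ⟨k, ?_⟩
  have : (2 * Real.pi * I : ℂ) ≠ 0 := Complex.two_pi_I_ne_zero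
  rw [mul_comm] at hk
  exact mul_right_cancel₀ this hk

lemma dot_identity {g n : ℕ} (Om : Matrix (Fin g) (Fin g) ℂ) (hsymm : Om.IsSymm)
    (Φ : Matrix (Fin g) (Fin n) ℂ) (P : Matrix (Fin g) (Fin n) ℂ)
    (Ω : Matrix (Fin n) (Fin n) ℂ)
    (hΩ : Ω = Pᵀ * Om * P) (hΦΩ : Φ * Ω = Om * P) (hPΦ : Pᵀ * Φ = 1)
    (γ : Fin g → ℂ) (z a : Fin n → ℂ) (m : Fin g → ℂ) (k : Fin n → ℂ)
    (hm : Φᵀ.mulVec m = a) (p : ℂ) :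
    p * ((m + P.mulVec k) ⬝ᵥ Om.mulVec (m + P.mulVec k)) +
      2 * p * ((m + P.mulVec k) ⬝ᵥ (Φ.mulVec z - γ)) =
    (p * (m ⬝ᵥ Om.mulVec m) - 2 * p * (m ⬝ᵥ γ) + 2 * p * (a ⬝ᵥ Pᵀ.mulVec γ) -
      p * (a ⬝ᵥ Ω.mulVec a)) +
    (p * ((k + a) ⬝ᵥ Ω.mulVec (k + a)) + 2 * p * ((k + a) ⬝ᵥ (z - Pᵀ.mulVec γ))) := by
  have hΩs : Ωᵀ = Ω := by
    rw [hΩ]; simp [Matrix.transpose_mul, hsymm.eq, Matrix.mul_assoc]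
  have hdot : ∀ {r s : ℕ} (A : Matrix (Fin r) (Fin s) ℂ) (x : Fin r → ℂ) (y : Fin s → ℂ),
      x ⬝ᵥ A.mulVec y = Aᵀ.mulVec x ⬝ᵥ y := by
    intro r s A x y
    rw [Matrix.dotProduct_mulVec, Matrix.mulVec_transpose]
  have e1 : m ⬝ᵥ Om.mulVec (P.mulVec k) = a ⬝ᵥ Ω.mulVec k := by
    rw [Matrix.mulVec_mulVec, ← hΦΩ, ← Matrix.mulVec_mulVec, hdot, hm]
  have e2 : P.mulVec k ⬝ᵥ Om.mulVec m = a ⬝ᵥ Ω.mulVec k := by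
    rw [← e1, hdot, hsymm.eq, dotProduct_comm]
  have hPk : ∀ y, P.mulVec k ⬝ᵥ y = k ⬝ᵥ Pᵀ.mulVec y := by
    intro y
    rw [hdot, Matrix.transpose_transpose]
  have e3 : P.mulVec k ⬝ᵥ Om.mulVec (P.mulVec k) = k ⬝ᵥ Ω.mulVec k := by
    rw [hPk, hΩ, Matrix.mulVec_mulVec, Matrix.mulVec_mulVec, Matrix.mul_assoc]
  have e4 : k ⬝ᵥ Ω.mulVec a = a ⬝ᵥ Ω.mulVec k := by
    rw [hdot, hΩs, dotProduct_comm]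
  have e5 : m ⬝ᵥ Φ.mulVec z = a ⬝ᵥ z := by rw [hdot, hm]
  have e6 : P.mulVec k ⬝ᵥ Φ.mulVec z = k ⬝ᵥ z := by
    rw [hPk, Matrix.mulVec_mulVec, hPΦ, Matrix.one_mulVec]
  have e7 := hPk γ
  simp only [Matrix.mulVec_add, add_dotProduct, dotProduct_add, dotProduct_sub, e1, e2, e3, e4, e5,
    e6, e7]
  ring

/-- Theorem 2 of the paper: expansion of the restricted theta
function θ(Φz − γ|Ω̃) in the theta functions with characteristics
θ[Δ⁻¹ε,0](z − Pᵀγ|Ω) of the abelian subvariety, with explicit coefficients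
c_ε. The sum over ε runs over the standard representatives 0 ≤ ε_j < δ_j of
ℤ^n/Δℤ^n. -/
theorem restricted_theta_expansion {g n : ℕ}
    (Om : Matrix (Fin g) (Fin g) ℂ)
    (hsymm : Om.IsSymm) (hpos : (Om.map Complex.im).PosDef)
    (δ : Fin n → ℕ) (hδ : ∀ j, 1 ≤ δ j)
    (Φ : Matrix (Fin g) (Fin n) ℂ) (P : Matrix (Fin g) (Fin n) ℤ)
    (Ω : Matrix (Fin n) (Fin n) ℂ)
    (hΩ : Ω = (P.map (Int.cast : ℤ → ℂ))ᵀ * Om * P.map (Int.cast : ℤ → ℂ))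
    (hΦΩ : Φ * Ω = Om * P.map (Int.cast : ℤ → ℂ))
    (hPΦ : (P.map (Int.cast : ℤ → ℂ))ᵀ * Φ = 1)
    (hper : ∀ (γ : Fin g → ℂ) (z : Fin n → ℂ) (k : Fin n → ℤ),
      theta Om 0 0 (Φ.mulVec (z + fun j => (δ j : ℂ) * (k j : ℂ)) - γ) =
        theta Om 0 0 (Φ.mulVec z - γ))
    (γ : Fin g → ℂ) (z : Fin n → ℂ) :
    theta Om 0 0 (Φ.mulVec z - γ) =
      ∑ ε : ∀ j, Fin (δ j),
        (∑' m : {m : Fin g → ℤ //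
            Φᵀ.mulVec (fun i => (m i : ℂ)) =
              fun j => ((ε j : ℕ) : ℂ) / (δ j : ℂ)},
          Complex.exp ((Real.pi : ℂ) * Complex.I *
              ((fun i => ((m : Fin g → ℤ) i : ℂ)) ⬝ᵥ
                Om.mulVec fun i => ((m : Fin g → ℤ) i : ℂ))
            - 2 * (Real.pi : ℂ) * Complex.I *
              ((fun i => ((m : Fin g → ℤ) i : ℂ)) ⬝ᵥ γ)
            + 2 * (Real.pi : ℂ) * Complex.I *
              ((fun j => ((ε j : ℕ) : ℂ)) ⬝ᵥ fun j =>
                ((P.map (Int.cast : ℤ → ℂ))ᵀ.mulVec γ) j / (δ j : ℂ))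
            - (Real.pi : ℂ) * Complex.I *
              ((fun j => ((ε j : ℕ) : ℂ) / (δ j : ℂ)) ⬝ᵥ
                Ω.mulVec fun j => ((ε j : ℕ) : ℂ) / (δ j : ℂ)))) *
        theta Ω (fun j => ((ε j : ℕ) : ℂ) / (δ j : ℂ)) 0
          (z - ((P.map (Int.cast : ℤ → ℂ))ᵀ).mulVec γ) := by
  classical
  have hδ0 : ∀ j, (δ j : ℂ) ≠ 0 := fun j => by
    have := hδ j
    exact_mod_cast (by omega : δ j ≠ 0)
  set Pc : Matrix (Fin g) (Fin n) ℂ := P.map (Int.cast : ℤ → ℂ) with hPc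
  have hΦP : Φᵀ * Pc = 1 := by
    rw [← Matrix.transpose_inj, Matrix.transpose_mul, Matrix.transpose_transpose, hPΦ,
      Matrix.transpose_one]
  have hcast : ∀ k : Fin n → ℤ, (fun i => ((P.mulVec k i : ℤ) : ℂ)) =
      Pc.mulVec (fun j => (k j : ℂ)) := by
    intro k
    ext i
    simp [hPc, Matrix.mulVec, dotProduct]
  have hintegral : ∀ (m : Fin g → ℤ) (j : Fin n),
      ∃ q : ℤ, (δ j : ℂ) * Φᵀ.mulVec (fun i => (m i : ℂ)) j = q := by
    intro m j
    obtain ⟨q, hq⟩ := period_int Om hpos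
      (Φ.mulVec (fun l => (δ l : ℂ) * ((Pi.single j 1 : Fin n → ℤ) l : ℂ))) (by
        intro w
        have := hper (-w) 0 (Pi.single j 1)
        simpa [add_comm] using this) m
    refine ⟨q, ?_⟩
    rw [← hq]
    have hv : (fun l => (δ l : ℂ) * ((Pi.single j 1 : Fin n → ℤ) l : ℂ)) =
        (Pi.single j (δ j : ℂ) : Fin n → ℂ) := by
      ext l
      by_cases hl : l = j
      · subst hl; simp
      · simp [hl]
    rw [hv, Matrix.mulVec_single]
    simp only [Matrix.mulVec, dotProduct, Matrix.transpose_apply, Finset.mul_sum]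
    refine Finset.sum_congr rfl fun i _ => ?_
    simp
    ring
  let F : (Σ ε : ∀ j, Fin (δ j), {m : Fin g → ℤ //
            Φᵀ.mulVec (fun i => (m i : ℂ)) =
              fun j => ((ε j : ℕ) : ℂ) / (δ j : ℂ)} × (Fin n → ℤ)) → (Fin g → ℤ) :=
    fun x => (x.2.1 : Fin g → ℤ) + P.mulVec x.2.2
  have hFc : ∀ x, (fun i => ((F x i : ℤ) : ℂ)) =
      (fun i => ((x.2.1 : Fin g → ℤ) i : ℂ)) + Pc.mulVec (fun j => (x.2.2 j : ℂ)) := by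
    intro x
    rw [← hcast]
    ext i
    simp [F]
  have hF1 : ∀ x j, (δ j : ℂ) * Φᵀ.mulVec (fun i => ((F x i : ℤ) : ℂ)) j =
      (((x.1 j : ℕ) : ℤ) + (δ j : ℤ) * x.2.2 j : ℤ) := by
    intro x j
    rw [hFc, Matrix.mulVec_add, Matrix.mulVec_mulVec, hΦP, Matrix.one_mulVec, x.2.1.2]
    simp only [Pi.add_apply]
    push_cast
    field_simp [hδ0 j]
  have hinj : Function.Injective F := by
    rintro ⟨ε, m, k⟩ ⟨ε', m', k'⟩ h
    have hj : ∀ j, ((ε j : ℕ) : ℤ) + (δ j : ℤ) * k j = ((ε' j : ℕ) : ℤ) + (δ j : ℤ) * k' j := by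
      intro j
      have h1 := hF1 ⟨ε, m, k⟩ j
      rw [h, hF1] at h1
      exact_mod_cast h1.symm
    have hε : ∀ j, ((ε j : ℕ) : ℤ) = ((ε' j : ℕ) : ℤ) := by
      intro j
      have h1 := congrArg (· % (δ j : ℤ)) (hj j)
      simp only [Int.add_mul_emod_self_left] at h1
      rwa [Int.emod_eq_of_lt (by positivity) (by exact_mod_cast (ε j).2),
        Int.emod_eq_of_lt (by positivity) (by exact_mod_cast (ε' j).2)] at h1
    obtain rfl : ε = ε' := by
      ext j
      exact_mod_cast hε j
    obtain rfl : k = k' := by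
      ext j
      have h1 := hj j
      have h2 : (δ j : ℤ) ≠ 0 := by have := hδ j; omega
      exact mul_left_cancel₀ h2 (add_left_cancel h1)
    obtain rfl : m = m' := by
      apply Subtype.ext
      exact add_right_cancel (b := P.mulVec k) h
    rfl
  have hsurj : Function.Surjective F := by
    intro m
    choose q hq using hintegral m
    have hp : ∀ j, (0 : ℤ) < δ j := fun j => by have := hδ j; omega
    have hlt : ∀ j, (q j % (δ j : ℤ)).toNat < δ j := fun j => by
      have := Int.emod_lt_of_pos (q j) (hp j)
      have := Int.emod_nonneg (q j) (hp j).ne'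
      omega
    refine ⟨⟨fun j => ⟨(q j % (δ j : ℤ)).toNat, hlt j⟩,
      ⟨⟨m - P.mulVec (fun j => q j / (δ j : ℤ)), ?_⟩, fun j => q j / (δ j : ℤ)⟩⟩, ?_⟩
    · have : (fun i => (((m - P.mulVec (fun j => q j / (δ j : ℤ))) i : ℤ) : ℂ)) =
          (fun i => (m i : ℂ)) - Pc.mulVec (fun j => ((q j / (δ j : ℤ) : ℤ) : ℂ)) := by
        rw [← hcast]
        ext i
        simp
      rw [this, Matrix.mulVec_sub, Matrix.mulVec_mulVec, hΦP, Matrix.one_mulVec]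
      ext j
      simp only [Pi.sub_apply]
      rw [eq_div_iff (hδ0 j), sub_mul, mul_comm, hq]
      have h1 : (((q j % (δ j : ℤ)).toNat : ℕ) : ℤ) = q j - (q j / (δ j : ℤ)) * δ j := by
        rw [Int.toNat_of_nonneg (Int.emod_nonneg (q j) (hp j).ne'), Int.emod_def]
        ring
      exact_mod_cast h1.symm
    · simp [F]
  have hsum := (summable_norm_thetaTerm Om hpos (Φ.mulVec z - γ)).of_norm
  unfold theta
  have hbij : Function.Bijective F := ⟨hinj, hsurj⟩
  have hsum' : Summable (fun x => thetaTerm Om 0 0 (Φ.mulVec z - γ) (F x)) :=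
    (Equiv.ofBijective F hbij).summable_iff.mpr hsum
  refine ((Equiv.ofBijective F hbij).tsum_eq _).symm.trans ?_
  refine (hsum'.tsum_sigma).trans ?_
  rw [tsum_fintype]
  refine Finset.sum_congr rfl fun ε _ => ?_
  refine ((hsum'.sigma_factor ε).tsum_prod).trans ?_
  rw [← tsum_mul_right]
  refine tsum_congr fun m => ?_
  rw [← tsum_mul_left]
  refine tsum_congr fun k => ?_
  unfold thetaTerm
  rw [← Complex.exp_add]
  congr 1
  have key := dot_identity Om hsymm Φ Pc Ω hΩ hΦΩ hPΦ γ z _ _ (fun j => (k j : ℂ)) m.2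
    ((Real.pi : ℂ) * Complex.I)
  rw [← hFc ⟨ε, m, k⟩] at key
  have ha : ((fun j => ((ε j : ℕ) : ℂ)) ⬝ᵥ fun j => (Pcᵀ.mulVec γ) j / (δ j : ℂ)) =
      (fun j => ((ε j : ℕ) : ℂ) / (δ j : ℂ)) ⬝ᵥ Pcᵀ.mulVec γ := by
    simp only [dotProduct]
    refine Finset.sum_congr rfl fun j _ => ?_
    ring
  rw [ha]
  simp only [Pi.zero_apply, add_zero, mul_assoc] at key ⊢
  exact key
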